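/- arXiv:2011.13346 — 7 statements merged into one kernel-verified Lean document; each statement's English description precedes it below -/
import Mathlib

section
/- Let f(t) = Σ_{j=1}^K γ_j cos(2π a_j t + b_j) with K ∈ ℕ, γ_j ∈ (0,∞), (a_j, b_j) ∈ (0,∞) × [0,2π) and a_1 < a_2 < … < a_K, and let g(t) = Σ_{j=1}^M δ_j cos(2π c_j t + d_j) with M ∈ ℕ, δ_j ∈ (0,∞), (c_j, d_j) ∈ (0,∞) × [0,2π) and c_1 < c_2 < … < c_M. If f(t) = g(t) for all t in an interval T ⊂ ℝ of positive length, then K = M and γ_j = δ_j, a_j = c_j, b_j = d_j for j = 1,…,K. -/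
open Real Finset

/-- Termwise differentiation of a trigonometric sum vanishing on an open set. -/
theorem sum_mul_cos_add_pi_div_two_eq_zero {ι : Type*} [Fintype ι] {x ω φ : ι → ℝ} {U : Set ℝ}
    (hU : IsOpen U) (h : ∀ t ∈ U, ∑ i, x i * Real.cos (ω i * t + φ i) = 0) :
    ∀ t ∈ U, ∑ i, x i * ω i * Real.cos (ω i * t + (φ i + π / 2)) = 0 := by
  intro t ht
  have hderiv : HasDerivAt (fun s => ∑ i, x i * Real.cos (ω i * s + φ i))
      (∑ i, x i * ω i * Real.cos (ω i * t + (φ i + π / 2))) t := by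
    refine HasDerivAt.fun_sum fun i _ => ?_
    have hlin : HasDerivAt (fun s => ω i * s + φ i) (ω i) t := by
      simpa using ((hasDerivAt_id t).const_mul (ω i)).add_const (φ i)
    refine (hlin.cos.const_mul (x i)).congr_deriv ?_
    rw [← add_assoc, Real.cos_add_pi_div_two]
    ring
  have hzero : (fun s => ∑ i, x i * Real.cos (ω i * s + φ i)) =ᶠ[nhds t] fun _ => 0 :=
    Filter.eventually_of_mem (hU.mem_nhds ht) h
  exact hderiv.unique ((hasDerivAt_const t (0 : ℝ)).congr_of_eventuallyEq hzero)

theorem sum_mul_sq_pow_mul_cos_eq_zero {ι : Type*} [Fintype ι] {x ω φ : ι → ℝ} {U : Set ℝ}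
    (hU : IsOpen U) (h : ∀ t ∈ U, ∑ i, x i * Real.cos (ω i * t + φ i) = 0) (n : ℕ) :
    ∀ t ∈ U, ∑ i, x i * (ω i ^ 2) ^ n * Real.cos (ω i * t + φ i) = 0 := by
  induction n with
  | zero => simpa using h
  | succ n ih =>
    intro t ht
    have key := sum_mul_cos_add_pi_div_two_eq_zero hU
      (sum_mul_cos_add_pi_div_two_eq_zero hU ih) t ht
    rw [← neg_eq_zero, ← key, ← Finset.sum_neg_distrib]
    refine Finset.sum_congr rfl fun i _ => ?_
    rw [show ω i * t + (φ i + π / 2 + π / 2) = ω i * t + φ i + π by ring, Real.cos_add_pi]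
    ring

/-- If a trigonometric sum vanishes on an open set, so does its part of any given frequency. -/
theorem sum_ite_frequency_eq_zero {ι : Type*} [Fintype ι] {x ω φ : ι → ℝ} {U : Set ℝ}
    (hU : IsOpen U) (hω : ∀ i, 0 < ω i)
    (h : ∀ t ∈ U, ∑ i, x i * Real.cos (ω i * t + φ i) = 0) {w : ℝ} (hw : 0 < w) :
    ∀ t ∈ U, ∑ i, (if ω i = w then x i * Real.cos (ω i * t + φ i) else 0) = 0 := by
  intro t ht
  have hpoly (p : Polynomial ℝ) :
      ∑ i, p.eval (ω i ^ 2) * (x i * Real.cos (ω i * t + φ i)) = 0 := by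
    simp_rw [Polynomial.eval_eq_sum_range, Finset.sum_mul]
    rw [Finset.sum_comm]
    refine Finset.sum_eq_zero fun n _ => ?_
    rw [← mul_zero (p.coeff n), ← sum_mul_sq_pow_mul_cos_eq_zero hU h n t ht, Finset.mul_sum]
    exact Finset.sum_congr rfl fun i _ => by ring
  refine Eq.trans (Finset.sum_congr rfl fun i hi => ?_)
    (hpoly (Lagrange.interpolate (Finset.univ.image fun i => ω i ^ 2) id
      fun y => if y = w ^ 2 then 1 else 0))
  have heval := Lagrange.eval_interpolate_at_node (fun y : ℝ => if y = w ^ 2 then (1 : ℝ) else 0)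
    (Function.injective_id.injOn (s := ((Finset.univ.image fun i => ω i ^ 2 : Finset ℝ) : Set ℝ)))
    (Finset.mem_image_of_mem (fun i => ω i ^ 2) hi)
  rw [id_eq] at heval
  rw [heval]
  simp only [pow_left_inj₀ (hω i).le hw.le two_ne_zero, ite_mul, one_mul, zero_mul]

/-- If two trigonometric sums agree on an open set, so do their parts of any given frequency. -/
theorem sum_ite_frequency_eq {ι κ : Type*} [Fintype ι] [Fintype κ] {γ a b : ι → ℝ}
    {δ c d : κ → ℝ} {U : Set ℝ} (hU : IsOpen U) (ha : ∀ i, 0 < a i) (hc : ∀ i, 0 < c i)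
    (h : ∀ t ∈ U, ∑ i, γ i * Real.cos (a i * t + b i) = ∑ i, δ i * Real.cos (c i * t + d i))
    {w : ℝ} (hw : 0 < w) :
    ∀ t ∈ U, ∑ i, (if a i = w then γ i * Real.cos (a i * t + b i) else 0)
      = ∑ i, (if c i = w then δ i * Real.cos (c i * t + d i) else 0) := by
  intro t ht
  have key := sum_ite_frequency_eq_zero (x := Sum.elim γ fun i => -δ i) (ω := Sum.elim a c)
    (φ := Sum.elim b d) hU (by rintro (i | i) <;> simp [ha, hc])
    (fun s hs => by simp [Fintype.sum_sum_type, h s hs]) hw t ht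
  rw [← sub_eq_zero]
  refine Eq.trans ?_ key
  rw [Fintype.sum_sum_type, sub_eq_add_neg, ← Finset.sum_neg_distrib]
  refine congrArg₂ (· + ·) rfl (Finset.sum_congr rfl fun i _ => ?_)
  by_cases hi : c i = w <;> simp [hi]

/-- Amplitude and phase (modulo `2π`) of a single wave are determined on any open set. -/
theorem amplitude_eq_and_phase_eq {γ δ w b d : ℝ} {U : Set ℝ} (hU : IsOpen U)
    (hne : U.Nonempty) (hγ : 0 < γ) (hδ : 0 ≤ δ) (hw : w ≠ 0)
    (h : ∀ t ∈ U, γ * Real.cos (w * t + b) = δ * Real.cos (w * t + d)) :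
    γ = δ ∧ (b : Real.Angle) = d := by
  obtain ⟨t, ht⟩ := hne
  have hcos := h t ht
  have hsin : γ * Real.sin (w * t + b) = δ * Real.sin (w * t + d) := by
    have key := sum_mul_cos_add_pi_div_two_eq_zero (x := ![γ, -δ]) (ω := ![w, w]) (φ := ![b, d])
      hU (fun s hs => by simp [Fin.sum_univ_two, h s hs]) t ht
    simp only [Fin.sum_univ_two, Matrix.cons_val_zero, Matrix.cons_val_one, ← add_assoc,
      Real.cos_add_pi_div_two] at key
    refine mul_left_cancel₀ hw ?_
    linarith
  have hamp : γ = δ := by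
    rw [← pow_left_inj₀ hγ.le hδ two_ne_zero]
    have hb := Real.sin_sq_add_cos_sq (w * t + b)
    have hd := Real.sin_sq_add_cos_sq (w * t + d)
    calc γ ^ 2 = (γ * Real.sin (w * t + b)) ^ 2 + (γ * Real.cos (w * t + b)) ^ 2 := by
          linear_combination -γ ^ 2 * hb
      _ = δ ^ 2 := by
          rw [hsin, hcos]
          linear_combination δ ^ 2 * hd
  subst hamp
  refine ⟨rfl, ?_⟩
  have hangle := Real.Angle.cos_sin_inj (mul_left_cancel₀ hγ.ne' hcos)
    (mul_left_cancel₀ hγ.ne' hsin)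
  simpa using hangle

theorem eq_of_coe_angle_eq {b d : ℝ} (hb : b ∈ Set.Ico 0 (2 * π)) (hd : d ∈ Set.Ico 0 (2 * π))
    (h : (b : Real.Angle) = d) : b = d := by
  obtain ⟨k, hk⟩ := Real.Angle.angle_eq_iff_two_pi_dvd_sub.1 h
  have hlt : (k : ℝ) < 1 := by nlinarith [hb.2, hd.1, Real.pi_pos]
  have hgt : (-1 : ℝ) < k := by nlinarith [hb.1, hd.2, Real.pi_pos]
  have hk0 : k = 0 := by
    have h1 : k < 1 := by exact_mod_cast hlt
    have h2 : -1 < k := by exact_mod_cast hgt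
    omega
  rw [hk0, Int.cast_zero, mul_zero] at hk
  exact sub_eq_zero.1 hk

theorem sum_ite_apply_eq {ι : Type*} [Fintype ι] {a : ι → ℝ} (ha : Function.Injective a)
    (F : ι → ℝ) (i : ι) : ∑ j, (if a j = a i then F j else 0) = F i :=
  (Fintype.sum_eq_single i fun _ hj => if_neg (ha.ne hj)).trans (if_pos rfl)

/-- Each wave of a trigonometric sum occurs in any other such sum agreeing with it on a nonempty
open set. -/
theorem exists_frequency_eq {ι κ : Type*} [Fintype ι] [Fintype κ] {γ a b : ι → ℝ}
    {δ c d : κ → ℝ} {U : Set ℝ} (hU : IsOpen U) (hne : U.Nonempty) (hγ : ∀ i, 0 < γ i)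
    (hδ : ∀ i, 0 < δ i) (ha : ∀ i, 0 < a i) (hc : ∀ i, 0 < c i)
    (ha' : Function.Injective a) (hc' : Function.Injective c)
    (h : ∀ t ∈ U, ∑ i, γ i * Real.cos (a i * t + b i) = ∑ i, δ i * Real.cos (c i * t + d i))
    (i : ι) : ∃ k, c k = a i ∧ γ i = δ k ∧ (b i : Real.Angle) = d k := by
  have key := sum_ite_frequency_eq hU ha hc h (ha i)
  simp only [sum_ite_apply_eq ha'] at key
  by_cases hk : ∃ k, c k = a i
  · obtain ⟨k, hk⟩ := hk
    simp only [← hk, sum_ite_apply_eq hc'] at key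
    exact ⟨k, hk, amplitude_eq_and_phase_eq hU hne (hγ i) (hδ k).le (hc k).ne' key⟩
  · push Not at hk
    simp only [hk, if_false, Finset.sum_const_zero] at key
    exact absurd (amplitude_eq_and_phase_eq (d := 0) hU hne (hγ i) le_rfl (ha i).ne'
      fun t ht => by rw [key t ht, zero_mul]).1 (hγ i).ne'

/-- **Uniqueness of non-harmonic Fourier sums.**
If two non-harmonic Fourier sums (with positive amplitudes, strictly increasing positive
frequencies and phases in `[0, 2π)`) agree on an interval of positive length, then they have
the same number of terms and identical parameters. -/
theorem statement0 (K M : ℕ) (hK : 0 < K) (hM : 0 < M)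
    (γ a b : Fin K → ℝ) (δ c d : Fin M → ℝ)
    (hγ : ∀ j, 0 < γ j) (ha : ∀ j, 0 < a j)
    (hb : ∀ j, b j ∈ Set.Ico 0 (2 * π))
    (haMono : StrictMono a)
    (hδ : ∀ j, 0 < δ j) (hc : ∀ j, 0 < c j)
    (hd : ∀ j, d j ∈ Set.Ico 0 (2 * π))
    (hcMono : StrictMono c)
    (t₀ t₁ : ℝ) (ht : t₀ < t₁)
    (heq : ∀ t ∈ Set.Ioo t₀ t₁,
      ∑ j, γ j * Real.cos (2 * π * a j * t + b j)
        = ∑ j, δ j * Real.cos (2 * π * c j * t + d j)) :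
    ∃ h : K = M, ∀ j : Fin K,
      γ j = δ (Fin.cast h j) ∧ a j = c (Fin.cast h j) ∧ b j = d (Fin.cast h j) := by
  have h2π : 2 * π ≠ 0 := Real.two_pi_pos.ne'
  have hne : (Set.Ioo t₀ t₁).Nonempty := Set.nonempty_Ioo.2 ht
  have ha' : ∀ j, 0 < 2 * π * a j := fun j => mul_pos Real.two_pi_pos (ha j)
  have hc' : ∀ j, 0 < 2 * π * c j := fun j => mul_pos Real.two_pi_pos (hc j)
  have haInj : Function.Injective fun j => 2 * π * a j :=
    (mul_right_injective₀ h2π).comp haMono.injective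
  have hcInj : Function.Injective fun j => 2 * π * c j :=
    (mul_right_injective₀ h2π).comp hcMono.injective
  have hfg : ∀ j, ∃ k, c k = a j ∧ γ j = δ k ∧ (b j : Real.Angle) = d k := by
    simpa [Real.pi_ne_zero] using
      exists_frequency_eq isOpen_Ioo hne hγ hδ ha' hc' haInj hcInj heq
  have hgf : ∀ k, ∃ j, a j = c k ∧ δ k = γ j ∧ (d k : Real.Angle) = b j := by
    simpa [Real.pi_ne_zero] using
      exists_frequency_eq isOpen_Ioo hne hδ hγ hc' ha' hcInj haInj fun t ht => (heq t ht).symm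
  have hrange : Set.range a = Set.range c := by
    apply Set.Subset.antisymm
    · rintro _ ⟨j, rfl⟩
      exact (hfg j).imp fun _ => And.left
    · rintro _ ⟨k, rfl⟩
      exact (hgf k).imp fun _ => And.left
  have hKM : K = M := by
    simpa [Set.ncard_range_of_injective haMono.injective,
      Set.ncard_range_of_injective hcMono.injective] using congrArg Set.ncard hrange
  subst hKM
  refine ⟨rfl, fun j => ?_⟩
  have hac : a = c := (haMono.range_inj hcMono).1 hrange
  obtain ⟨k, hk, hamp, hphase⟩ := hfg j
  obtain rfl : k = j := hcMono.injective (hk.trans (congrFun hac j))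
  exact ⟨hamp, hk.symm, eq_of_coe_angle_eq (hb k) (hd k) hphase⟩
end

section
/- Let f(t) = Σ_{j=1}^K γ_j cos(2π a_j t + b_j) with γ_j ∈ (0,∞), pairwise distinct a_j ∈ (0,∞), b_j ∈ [0,2π), let P > 0, and suppose a_j P ∉ ℕ for all j. Define C_j = a_j² P², A_j = −(P γ_j a_j/π) sin(a_j πP) cos(a_j πP + b_j), and B_j = −(γ_j/π) sin(a_j πP) sin(a_j πP + b_j). Then for every n ∈ ℤ the Fourier coefficient of f with respect to (0,P) satisfies c_n(f) = Σ_{j=1}^K (A_j + i B_j n)/(n² − C_j). -/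
open Real Finset

/-- The classical Fourier coefficient `c_n(f)` of `f : ℝ → ℝ` with respect to the
interval `(0, P)`: `c_n(f) = (1/P) ∫₀^P f(t) e^{-2πi n t / P} dt`. -/
noncomputable def fourierCoef (P : ℝ) (f : ℝ → ℝ) (n : ℤ) : ℂ :=
  (1 / (P : ℂ)) * ∫ t in (0:ℝ)..P,
    (f t : ℂ) * Complex.exp (-2 * (π : ℂ) * Complex.I * (n : ℂ) * (t : ℂ) / (P : ℂ))

theorem integral_cos_mul_exp {ω k : ℂ} (hωk : ω ^ 2 - k ^ 2 ≠ 0) (b : ℂ) (u v : ℝ) :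
    ∫ t in u..v, Complex.cos (ω * t + b) * Complex.exp (-(Complex.I * k * t))
      = (ω * Complex.sin (ω * v + b) - Complex.I * k * Complex.cos (ω * v + b))
            * Complex.exp (-(Complex.I * k * v)) / (ω ^ 2 - k ^ 2)
        - (ω * Complex.sin (ω * u + b) - Complex.I * k * Complex.cos (ω * u + b))
            * Complex.exp (-(Complex.I * k * u)) / (ω ^ 2 - k ^ 2) := by
  refine intervalIntegral.integral_eq_sub_of_hasDerivAt
    (f := fun t : ℝ ↦ (ω * Complex.sin (ω * t + b) - Complex.I * k * Complex.cos (ω * t + b))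
      * Complex.exp (-(Complex.I * k * t)) / (ω ^ 2 - k ^ 2)) (fun t _ ↦ ?_)
    (Continuous.intervalIntegrable (by fun_prop) _ _)
  have hphase : HasDerivAt (fun t : ℂ ↦ ω * t + b) ω t := by
    simpa using ((hasDerivAt_id (t : ℂ)).const_mul ω).add_const b
  have hexp : HasDerivAt (fun t : ℂ ↦ -(Complex.I * k * t)) (-(Complex.I * k)) t := by
    simpa using ((hasDerivAt_id (t : ℂ)).const_mul (Complex.I * k)).fun_neg
  have hderiv := ((((hphase.csin.const_mul ω).sub
    (hphase.ccos.const_mul (Complex.I * k))).mul hexp.cexp).div_const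
      (ω ^ 2 - k ^ 2)).comp_ofReal
  refine hderiv.congr_deriv ?_
  rw [div_eq_iff hωk, Pi.sub_apply]
  linear_combination k ^ 2 * Complex.cos (ω * t + b) *
    Complex.exp (-(Complex.I * k * t)) * Complex.I_sq

theorem exp_neg_I_mul_two_pi_mul_int_div_mul_self {P : ℝ} (hP : P ≠ 0) (n : ℤ) :
    Complex.exp (-(Complex.I * (2 * π * n / P) * P)) = 1 := by
  have hPc : (P : ℂ) ≠ 0 := Complex.ofReal_ne_zero.mpr hP
  rw [Complex.exp_eq_one_iff]
  refine ⟨-n, ?_⟩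
  push_cast
  field_simp

theorem int_sq_ne_mul_sq {a P : ℝ} (ha : 0 < a * P) (hnp : ∀ m : ℕ, a * P ≠ m) (n : ℤ) :
    (n : ℝ) ^ 2 ≠ a ^ 2 * P ^ 2 := by
  intro h
  apply hnp n.natAbs
  rw [← mul_pow, sq_eq_sq_iff_abs_eq_abs, abs_of_pos ha] at h
  rw [← h, Nat.cast_natAbs, Int.cast_abs]

theorem fourierCoef_cos {P : ℝ} (hP : P ≠ 0) (a b : ℝ) (n : ℤ)
    (h : (n : ℝ) ^ 2 ≠ a ^ 2 * P ^ 2) :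
    fourierCoef P (fun t ↦ Real.cos (2 * π * a * t + b)) n
      = -(Complex.sin (a * π * P) / π) * (P * a * Complex.cos (a * π * P + b)
          + Complex.I * n * Complex.sin (a * π * P + b))
        / ((n : ℂ) ^ 2 - a ^ 2 * P ^ 2) := by
  have hPc : (P : ℂ) ≠ 0 := Complex.ofReal_ne_zero.mpr hP
  have hπ : (π : ℂ) ≠ 0 := Complex.ofReal_ne_zero.mpr Real.pi_ne_zero
  have hden : (n : ℂ) ^ 2 - a ^ 2 * P ^ 2 ≠ 0 := sub_ne_zero.mpr (by exact_mod_cast h)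
  have hsub : (2 * π * a : ℂ) ^ 2 - (2 * π * n / P) ^ 2
      = -(4 * π ^ 2 / P ^ 2) * ((n : ℂ) ^ 2 - a ^ 2 * P ^ 2) := by
    field_simp
    ring
  have hωk : (2 * π * a : ℂ) ^ 2 - (2 * π * n / P) ^ 2 ≠ 0 := by
    rw [hsub]
    exact mul_ne_zero (by simp [hP, Real.pi_ne_zero]) hden
  have hint : ∀ t : ℝ, ((Real.cos (2 * π * a * t + b) : ℝ) : ℂ)
      * Complex.exp (-2 * π * Complex.I * n * t / P)
      = Complex.cos (2 * π * a * t + b) * Complex.exp (-(Complex.I * (2 * π * n / P) * t)) := by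
    intro t
    push_cast
    congr 2
    ring
  have hsin : Complex.sin (2 * π * a * P + b) - Complex.sin b
      = 2 * Complex.sin (a * π * P) * Complex.cos (a * π * P + b) := by
    rw [Complex.sin_sub_sin]
    ring_nf
  have hcos : Complex.cos (2 * π * a * P + b) - Complex.cos b
      = -2 * Complex.sin (a * π * P + b) * Complex.sin (a * π * P) := by
    rw [Complex.cos_sub_cos]
    ring_nf
  simp only [fourierCoef, hint]
  rw [integral_cos_mul_exp hωk, exp_neg_I_mul_two_pi_mul_int_div_mul_self hP, hsub]
  simp only [Complex.ofReal_zero, mul_zero, zero_add, neg_zero, Complex.exp_zero, mul_one]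
  rw [eq_add_of_sub_eq hsin, eq_add_of_sub_eq hcos]
  field_simp
  ring

theorem fourierCoef_sum {ι : Type*} (s : Finset ι) (P : ℝ) (c : ι → ℝ) (g : ι → ℝ → ℝ)
    (hg : ∀ j ∈ s, Continuous (g j)) (n : ℤ) :
    fourierCoef P (fun t ↦ ∑ j ∈ s, c j * g j t) n = ∑ j ∈ s, c j * fourierCoef P (g j) n := by
  simp only [fourierCoef, Complex.ofReal_sum, Complex.ofReal_mul, Finset.sum_mul, mul_assoc]
  rw [intervalIntegral.integral_finsetSum, Finset.mul_sum]
  · refine Finset.sum_congr rfl fun j _ ↦ ?_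
    rw [intervalIntegral.integral_const_mul]
    ring
  · intro j hj
    have := hg j hj
    exact Continuous.intervalIntegrable (by fun_prop) _ _

/-- **Partial fraction representation of the Fourier coefficients of a non-harmonic
Fourier sum.** If `f(t) = Σ_j γ_j cos(2π a_j t + b_j)` with positive amplitudes, pairwise
distinct positive frequencies `a_j` satisfying `a_j P ∉ ℕ`, and phases in `[0, 2π)`, then
with `C_j = a_j²P²`, `A_j = -(Pγ_j a_j/π) sin(a_jπP) cos(a_jπP + b_j)` and
`B_j = -(γ_j/π) sin(a_jπP) sin(a_jπP + b_j)`, every Fourier coefficient satisfies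
`c_n(f) = Σ_j (A_j + i B_j n)/(n² − C_j)`. -/
theorem statement5 (P : ℝ) (hP : 0 < P) (K : ℕ) (hK : 0 < K)
    (γ a b : Fin K → ℝ) (hγ : ∀ j, 0 < γ j) (ha : ∀ j, 0 < a j)
    (hainj : Function.Injective a) (hb : ∀ j, b j ∈ Set.Ico 0 (2 * π))
    (hnp : ∀ j, ∀ m : ℕ, a j * P ≠ (m : ℝ))
    (f : ℝ → ℝ) (hf : ∀ t, f t = ∑ j, γ j * Real.cos (2 * π * a j * t + b j))
    (Cp Ap Bp : Fin K → ℝ)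
    (hC : ∀ j, Cp j = (a j) ^ 2 * P ^ 2)
    (hA : ∀ j, Ap j = -(P * γ j * a j / π)
      * Real.sin (a j * π * P) * Real.cos (a j * π * P + b j))
    (hB : ∀ j, Bp j = -(γ j / π)
      * Real.sin (a j * π * P) * Real.sin (a j * π * P + b j)) :
    ∀ n : ℤ, fourierCoef P f n
      = ∑ j, ((Ap j : ℂ) + Complex.I * (Bp j : ℂ) * (n : ℂ)) / ((n : ℂ) ^ 2 - (Cp j : ℂ)) := by
  intro n
  rw [funext hf, fourierCoef_sum _ _ _ _ (fun j _ ↦ by fun_prop)]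
  refine Finset.sum_congr rfl fun j _ ↦ ?_
  rw [fourierCoef_cos hP.ne' _ _ _ (int_sq_ne_mul_sq (mul_pos (ha j) hP) (hnp j) n),
    hA, hB, hC]
  push_cast
  ring
end

section
/- Let P > 0, γ ∈ (0,∞), a ∈ (0,∞) with aP ∉ ℕ, b ∈ [0,2π), and define C = a² P², A = −(P γ a/π) sin(aπP) cos(aπP + b), B = −(γ/π) sin(aπP) sin(aπP + b). Then C > 0, a = √C / P, and γ = (π / (√C · |sin(√C π)|)) · √(A² + C B²). -/
open Real

/-- **Recovery of frequency and amplitude from the partial-fraction parameters.**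
With `C = a²P²`, `A = −(Pγa/π) sin(aπP) cos(aπP + b)`, `B = −(γ/π) sin(aπP) sin(aπP + b)`
(for `γ, a > 0`, `aP ∉ ℕ`, `b ∈ [0, 2π)`, `P > 0`), one has `C > 0`, `a = √C / P` and
`γ = (π/(√C · |sin(√C π)|)) √(A² + C B²)`. -/
theorem statement7 (P γ a b : ℝ) (hP : 0 < P) (hγ : 0 < γ) (ha : 0 < a)
    (hnp : ∀ m : ℕ, a * P ≠ (m : ℝ)) (hb : b ∈ Set.Ico 0 (2 * π))
    (C A B : ℝ)
    (hC : C = a ^ 2 * P ^ 2)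
    (hA : A = -(P * γ * a / π) * Real.sin (a * π * P) * Real.cos (a * π * P + b))
    (hB : B = -(γ / π) * Real.sin (a * π * P) * Real.sin (a * π * P + b)) :
    0 < C ∧ a = Real.sqrt C / P ∧
      γ = π / (Real.sqrt C * |Real.sin (Real.sqrt C * π)|)
        * Real.sqrt (A ^ 2 + C * B ^ 2) := by
  have hπ := Real.pi_pos
  have hx : 0 < a * P := mul_pos ha hP
  have hsqrt : Real.sqrt C = a * P := by
    rw [hC, ← mul_pow, Real.sqrt_sq hx.le]
  have hsin : Real.sin (a * P * π) ≠ 0 := by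
    intro h
    obtain ⟨n, hn⟩ := Real.sin_eq_zero_iff.mp h
    have hn' : (n : ℝ) = a * P := mul_right_cancel₀ hπ.ne' hn
    have hn0 : 0 ≤ n := by
      have : (0 : ℝ) ≤ n := hn' ▸ hx.le
      exact_mod_cast this
    lift n to ℕ using hn0
    exact hnp n (by simpa using hn'.symm)
  have hcomm : a * π * P = a * P * π := by ring
  have hsq : A ^ 2 + C * B ^ 2 = (a * P * γ / π * |Real.sin (a * P * π)|) ^ 2 := by
    rw [hA, hB, hC, hcomm, mul_pow _ |_|, sq_abs]
    linear_combination (a * P * γ / π) ^ 2 * Real.sin (a * P * π) ^ 2 *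
      Real.sin_sq_add_cos_sq (a * P * π + b)
  refine ⟨by rw [hC]; positivity, by rw [hsqrt]; field_simp, ?_⟩
  have habs : 0 < |Real.sin (a * P * π)| := abs_pos.mpr hsin
  rw [hsq, Real.sqrt_sq (by positivity), hsqrt]
  generalize |Real.sin (a * P * π)| = s at habs ⊢
  field_simp
end

section
/- Let K ∈ ℕ, let p ∈ ℂ[z] have degree at most K−1, let q ∈ ℂ[z] be monic of degree K, and suppose p and q are coprime. Let z_1, …, z_{2K} ∈ ℂ be pairwise distinct with q(z_j) ≠ 0 for all j. If p̆, q̆ ∈ ℂ[z] are polynomials of degree at most K−1 satisfying p̆(z_j) q(z_j) = p(z_j) q̆(z_j) for j = 1,…,2K, then p̆ = 0 and q̆ = 0. In particular, a rational function p/q of this form is uniquely determined by its values at any 2K distinct points that are not poles. -/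
open Polynomial

/-- **Uniqueness of rational interpolation of type `(K−1, K)` at `2K` points.**
Let `p ∈ ℂ[z]` have degree at most `K−1`, let `q ∈ ℂ[z]` be monic of degree `K` and coprime
to `p`, and let `z₁, …, z_{2K}` be pairwise distinct non-poles (`q(z_j) ≠ 0`). If `p̆, q̆` are
polynomials of degree at most `K−1` with `p̆(z_j) q(z_j) = p(z_j) q̆(z_j)` for all `j`,
then `p̆ = 0` and `q̆ = 0`; in particular `p/q` is determined by its values at the `z_j`. -/
theorem statement12 (K : ℕ) (hK : 0 < K) (p q : Polynomial ℂ)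
    (hpdeg : p.degree ≤ ((K - 1 : ℕ) : WithBot ℕ))
    (hq : q.Monic) (hqdeg : q.natDegree = K)
    (hcop : IsCoprime p q)
    (z : Fin (2 * K) → ℂ) (hz : Function.Injective z)
    (hqz : ∀ j, q.eval (z j) ≠ 0)
    (p' q' : Polynomial ℂ)
    (hp' : p'.degree ≤ ((K - 1 : ℕ) : WithBot ℕ))
    (hq' : q'.degree ≤ ((K - 1 : ℕ) : WithBot ℕ))
    (h : ∀ j, p'.eval (z j) * q.eval (z j) = p.eval (z j) * q'.eval (z j)) :
    p' = 0 ∧ q' = 0 := by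
  have hpn := natDegree_le_of_degree_le hpdeg
  have hpn' := natDegree_le_of_degree_le hp'
  have hqn' := natDegree_le_of_degree_le hq'
  have hdeg : (p' * q - p * q').natDegree < Fintype.card (Fin (2 * K)) := by
    have h₁ : (p' * q).natDegree ≤ 2 * K - 1 := natDegree_mul_le.trans (by omega)
    have h₂ : (p * q').natDegree ≤ 2 * K - 1 := natDegree_mul_le.trans (by omega)
    have h₃ := natDegree_sub_le_of_le h₁ h₂
    rw [Fintype.card_fin]
    omega
  have hzero : p' * q = p * q' :=
    sub_eq_zero.mp <| eq_zero_of_natDegree_lt_card_of_eval_eq_zero _ hz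
      (fun j => by simp [h j]) hdeg
  have hdvd : q ∣ q' := hcop.symm.dvd_of_dvd_mul_left (hzero ▸ dvd_mul_left q p')
  have hq'_zero : q' = 0 := eq_zero_of_dvd_of_natDegree_lt hdvd (by omega)
  refine ⟨?_, hq'_zero⟩
  simpa [hq'_zero, hq.ne_zero] using hzero
end

section
/- Let f(t) = Σ_{j=1}^K γ_j cos(2π a_j t + b_j) with K ∈ ℕ, γ_j ∈ (0,∞), where each pair (a_j, b_j) lies in (0,∞) × [0,2π) or in i(0,∞) × iℝ, and the a_j are pairwise distinct; let g(t) = Σ_{j=1}^M δ_j cos(2π c_j t + d_j) with M ∈ ℕ, δ_j ∈ (0,∞), each (c_j, d_j) in (0,∞) × [0,2π) or in i(0,∞) × iℝ, and the c_j pairwise distinct. If f(t) = g(t) for all t in an interval T ⊂ ℝ of positive length, then K = M and, after a suitable permutation of the summands, γ_j = δ_j, a_j = c_j, b_j = d_j for j = 1,…,K. -/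
open Real Finset

/-- The exponential `t ↦ exp (2π i z t)` as a multiplicative character of `(ℂ, +)`. -/
noncomputable def expChar (z : ℂ) : Multiplicative ℂ →* ℂ where
  toFun t := Complex.exp (2 * π * Complex.I * z * t.toAdd)
  map_one' := by simp
  map_mul' s t := by rw [← Complex.exp_add, toAdd_mul, mul_add]

theorem expChar_injective : Function.Injective expChar := by
  intro z w h
  have hder (v : ℂ) : HasDerivAt (fun t : ℂ ↦ Complex.exp (2 * π * Complex.I * v * t))
      (2 * π * Complex.I * v) 0 := by
    simpa using ((hasDerivAt_id (0 : ℂ)).const_mul (2 * π * Complex.I * v)).cexp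
  have hfun : (fun t : ℂ ↦ Complex.exp (2 * π * Complex.I * z * t))
      = fun t : ℂ ↦ Complex.exp (2 * π * Complex.I * w * t) :=
    funext fun t ↦ DFunLike.congr_fun h (Multiplicative.ofAdd t)
  have hzw := (hder z).unique (hfun ▸ hder w)
  exact mul_left_cancel₀ Complex.two_pi_I_ne_zero hzw

theorem linearIndependent_expChar :
    LinearIndependent ℂ (fun z : ℂ ↦ (expChar z : Multiplicative ℂ → ℂ)) :=
  (linearIndependent_monoidHom (Multiplicative ℂ) ℂ).comp expChar expChar_injective

/-- An exponential sum vanishing on a real interval has only zero coefficients. -/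
theorem eq_zero_of_expSum_eq_zero_on_Ioo (W : ℂ →₀ ℂ) {t₀ t₁ : ℝ} (ht : t₀ < t₁)
    (hW : ∀ t ∈ Set.Ioo t₀ t₁,
      W.sum (fun z w ↦ w * Complex.exp (2 * π * Complex.I * z * (t : ℂ))) = 0) : W = 0 := by
  set F : ℂ → ℂ := fun t ↦ ∑ z ∈ W.support, W z * Complex.exp (2 * π * Complex.I * z * t)
    with hF
  have hFan : AnalyticOnNhd ℂ F Set.univ := by
    refine DifferentiableOn.analyticOnNhd (Differentiable.differentiableOn ?_) isOpen_univ
    fun_prop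
  obtain ⟨m, hm⟩ := exists_between ht
  have hfreq : ∃ᶠ t in nhdsWithin (m : ℂ) {(m : ℂ)}ᶜ, F t = 0 := by
    have hmap : Filter.Tendsto (fun t : ℝ ↦ (t : ℂ)) (nhdsWithin m {m}ᶜ)
        (nhdsWithin (m : ℂ) {(m : ℂ)}ᶜ) := by
      refine Complex.continuous_ofReal.continuousWithinAt.tendsto_nhdsWithin ?_
      intro t h
      simpa using h
    refine hmap.frequently (Filter.Eventually.frequently ?_)
    filter_upwards [nhdsWithin_le_nhds (Ioo_mem_nhds hm.1 hm.2)] with t h using hW t h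
  have hzero := hFan.eqOn_zero_of_preconnected_of_frequently_eq_zero
    isPreconnected_univ (Set.mem_univ _) hfreq
  refine linearIndependent_iff.mp linearIndependent_expChar W (funext fun t ↦ ?_)
  rw [Finsupp.linearCombination_apply, Finsupp.sum, Finset.sum_apply]
  exact hzero (Set.mem_univ t.toAdd)

/-- The (doubled) coefficients of `∑ j, γ j * cos (2π a j t + b j)` as an exponential sum. -/
noncomputable def expCoeff {n : ℕ} (γ : Fin n → ℝ) (a b : Fin n → ℂ) : ℂ →₀ ℂ :=
  ∑ j, (Finsupp.single (a j) (γ j * Complex.exp (b j * Complex.I))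
    + Finsupp.single (-a j) (γ j * Complex.exp (-b j * Complex.I)))

theorem expCoeff_sum {n : ℕ} (γ : Fin n → ℝ) (a b : Fin n → ℂ) (t : ℂ) :
    (expCoeff γ a b).sum (fun z w ↦ w * Complex.exp (2 * π * Complex.I * z * t))
      = 2 * ∑ j, (γ j : ℂ) * Complex.cos (2 * (π : ℂ) * a j * t + b j) := by
  have h0 (z : ℂ) : (0 : ℂ) * Complex.exp (2 * π * Complex.I * z * t) = 0 := zero_mul _
  have hadd (z u v : ℂ) : (u + v) * Complex.exp (2 * π * Complex.I * z * t)
      = u * Complex.exp (2 * π * Complex.I * z * t)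
        + v * Complex.exp (2 * π * Complex.I * z * t) := add_mul _ _ _
  rw [expCoeff, ← Finsupp.sum_finsetSum_index h0 hadd, Finset.mul_sum]
  refine Finset.sum_congr rfl fun j _ ↦ ?_
  rw [Finsupp.sum_add_index' h0 hadd, Finsupp.sum_single_index (h0 _),
    Finsupp.sum_single_index (h0 _), mul_assoc (γ j : ℂ), mul_assoc (γ j : ℂ),
    ← Complex.exp_add, ← Complex.exp_add, mul_left_comm, Complex.two_cos, mul_add]
  ring_nf

/-- Admissible pairs: `(0,∞) × [0,2π)` or `i(0,∞) × iℝ`. -/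
def IsAdmissible (a b : ℂ) : Prop :=
  (a.im = 0 ∧ 0 < a.re ∧ b.im = 0 ∧ b.re ∈ Set.Ico 0 (2 * π)) ∨ (a.re = 0 ∧ 0 < a.im ∧ b.re = 0)

theorem IsAdmissible.ne_neg {a b c d : ℂ} (h : IsAdmissible a b) (h' : IsAdmissible c d) :
    a ≠ -c := by
  rintro rfl
  simp only [IsAdmissible, Complex.neg_re, Complex.neg_im] at h h'
  rcases h with h | h <;> rcases h' with h' | h' <;> linarith [h.1, h.2.1, h'.1, h'.2.1]

theorem IsAdmissible.eq_of_exp_eq {a b d : ℂ} (h : IsAdmissible a b) (h' : IsAdmissible a d)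
    (he : Complex.exp (b * Complex.I) = Complex.exp (d * Complex.I)) : b = d := by
  obtain ⟨n, hn⟩ := Complex.exp_eq_exp_iff_exists_int.mp he
  have hbd : b = d + n * (2 * π) := by
    apply mul_right_cancel₀ Complex.I_ne_zero
    rw [hn]; ring
  have hre : b.re = d.re + n * (2 * π) := by simpa using congrArg Complex.re hbd
  suffices hn0 : n = 0 by simpa [hn0] using hbd
  have hpi := Real.pi_pos
  rcases h with h | h <;> rcases h' with h' | h'
  · obtain ⟨-, -, -, h1, h2⟩ := h
    obtain ⟨-, -, -, h3, h4⟩ := h'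
    have hlt : (n : ℝ) < 1 := by nlinarith
    have hgt : (-1 : ℝ) < n := by nlinarith
    have hlt' : n < 1 := by exact_mod_cast hlt
    have hgt' : -1 < n := by exact_mod_cast hgt
    omega
  · linarith [h.2.1, h'.1]
  · linarith [h'.2.1, h.1]
  · rw [h.2.2, h'.2.2, zero_add, zero_eq_mul] at hre
    rcases hre with hre | hre
    · exact_mod_cast hre
    · linarith

theorem expCoeff_apply {n : ℕ} {γ : Fin n → ℝ} {a b : Fin n → ℂ}
    (hab : ∀ j, IsAdmissible (a j) (b j)) (ha : Function.Injective a) (j : Fin n) :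
    expCoeff γ a b (a j) = γ j * Complex.exp (b j * Complex.I) := by
  have hne (k : Fin n) : -a k ≠ a j := ((hab j).ne_neg (hab k)).symm
  simp [expCoeff, Finsupp.single_apply, hne, ha.eq_iff]

theorem expCoeff_apply_neg {n : ℕ} {γ : Fin n → ℝ} {a b : Fin n → ℂ}
    (hab : ∀ j, IsAdmissible (a j) (b j)) (ha : Function.Injective a) (j : Fin n) :
    expCoeff γ a b (-a j) = γ j * Complex.exp (-b j * Complex.I) := by
  have hne (k : Fin n) : a k ≠ -a j := (hab k).ne_neg (hab j)
  simp [expCoeff, Finsupp.single_apply, hne, ha.eq_iff]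

theorem exists_eq_of_expCoeff_ne_zero {n : ℕ} {γ : Fin n → ℝ} {a b : Fin n → ℂ}
    (hab : ∀ j, IsAdmissible (a j) (b j)) {z w : ℂ} (hz : IsAdmissible z w)
    (h : expCoeff γ a b z ≠ 0) : ∃ j, z = a j := by
  by_contra! hza
  have hne (k : Fin n) : -a k ≠ z := (hz.ne_neg (hab k)).symm
  exact h (by simp [expCoeff, hne, fun k ↦ (hza k).symm])

theorem exists_eq_of_expCoeff_eq {K M : ℕ} {γ : Fin K → ℝ} {a b : Fin K → ℂ}
    {δ : Fin M → ℝ} {c d : Fin M → ℂ} (hγ : ∀ j, 0 < γ j)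
    (hab : ∀ j, IsAdmissible (a j) (b j)) (ha : Function.Injective a) (hδ : ∀ j, 0 < δ j)
    (hcd : ∀ j, IsAdmissible (c j) (d j)) (hc : Function.Injective c)
    (h : expCoeff γ a b = expCoeff δ c d) (j : Fin K) :
    ∃ k, γ j = δ k ∧ a j = c k ∧ b j = d k := by
  have hγj : (γ j : ℂ) ≠ 0 := by exact_mod_cast (hγ j).ne'
  have hpos := expCoeff_apply (γ := γ) hab ha j
  have hneg := expCoeff_apply_neg (γ := γ) hab ha j
  obtain ⟨k, hk⟩ := exists_eq_of_expCoeff_ne_zero (γ := δ) hcd (hab j)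
    (by rw [← h, hpos]; exact mul_ne_zero hγj (Complex.exp_ne_zero _))
  rw [h, hk, expCoeff_apply hcd hc] at hpos
  rw [h, hk, expCoeff_apply_neg hcd hc] at hneg
  have hsq : (δ k : ℂ) ^ 2 = (γ j : ℂ) ^ 2 := by
    have hinv (v : ℂ) : Complex.exp (v * Complex.I) * Complex.exp (-v * Complex.I) = 1 := by
      rw [← Complex.exp_add]; simp
    have hprod := congrArg₂ (· * ·) hpos hneg
    simp only [mul_mul_mul_comm _ (Complex.exp _), hinv, mul_one] at hprod
    rw [sq, sq, hprod]
  have hδγ : δ k = γ j :=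
    (sq_eq_sq₀ (hδ k).le (hγ j).le).mp (by exact_mod_cast hsq)
  rw [hδγ] at hpos
  exact ⟨k, hδγ.symm, hk,
    (hab j).eq_of_exp_eq (hk ▸ hcd k) (mul_left_cancel₀ hγj hpos).symm⟩

/-- **Uniqueness for the generalized model with real or purely imaginary parameters.**
If two generalized non-harmonic Fourier sums — each term `γ_j cos(2π a_j t + b_j)` with
`γ_j > 0` and `(a_j, b_j)` either in `(0,∞) × [0,2π)` or in `i(0,∞) × iℝ`, and with
pairwise distinct frequencies — agree on an interval of positive length, then they have the
same number of terms and, after a suitable permutation, identical parameters. -/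
theorem statement16 (K M : ℕ) (hK : 0 < K) (hM : 0 < M)
    (γ : Fin K → ℝ) (a b : Fin K → ℂ)
    (δ : Fin M → ℝ) (c d : Fin M → ℂ)
    (hγ : ∀ j, 0 < γ j)
    (hab : ∀ j, ((a j).im = 0 ∧ 0 < (a j).re ∧ (b j).im = 0
        ∧ (b j).re ∈ Set.Ico 0 (2 * π))
      ∨ ((a j).re = 0 ∧ 0 < (a j).im ∧ (b j).re = 0))
    (hainj : Function.Injective a)
    (hδ : ∀ j, 0 < δ j)
    (hcd : ∀ j, ((c j).im = 0 ∧ 0 < (c j).re ∧ (d j).im = 0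
        ∧ (d j).re ∈ Set.Ico 0 (2 * π))
      ∨ ((c j).re = 0 ∧ 0 < (c j).im ∧ (d j).re = 0))
    (hcinj : Function.Injective c)
    (t₀ t₁ : ℝ) (ht : t₀ < t₁)
    (heq : ∀ t ∈ Set.Ioo t₀ t₁,
      ∑ j, (γ j : ℂ) * Complex.cos (2 * (π : ℂ) * a j * (t : ℂ) + b j)
        = ∑ j, (δ j : ℂ) * Complex.cos (2 * (π : ℂ) * c j * (t : ℂ) + d j)) :
    ∃ σ : Fin K ≃ Fin M, ∀ j, γ j = δ (σ j) ∧ a j = c (σ j) ∧ b j = d (σ j) := by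
  have hcoeff : expCoeff γ a b = expCoeff δ c d := by
    refine sub_eq_zero.mp (eq_zero_of_expSum_eq_zero_on_Ioo _ ht fun t h ↦ ?_)
    rw [Finsupp.sum_sub_index fun _ _ _ ↦ sub_mul _ _ _, expCoeff_sum, expCoeff_sum,
      heq t h, sub_self]
  choose σ hσ using exists_eq_of_expCoeff_eq hγ hab hainj hδ hcd hcinj hcoeff
  have hinj : Function.Injective σ := fun i j hij ↦
    hainj (by rw [(hσ i).2.1, (hσ j).2.1, hij])
  have hsurj : Function.Surjective σ := fun k ↦ by
    obtain ⟨j, -, hj, -⟩ := exists_eq_of_expCoeff_eq hδ hcd hcinj hγ hab hainj hcoeff.symm k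
    exact ⟨j, hcinj (by rw [← (hσ j).2.1, hj])⟩
  exact ⟨Equiv.ofBijective σ ⟨hinj, hsurj⟩, hσ⟩
end

section
/- Let φ(t) = γ cosh(2π ã t + b̃) with γ ∈ (0,∞), ã ∈ (0,∞), b̃ ∈ ℝ (equivalently φ(t) = γ cos(2π a t + b) with a = i ã, b = i b̃), and let P > 0. Then for every n ∈ ℕ₀ the Fourier coefficients with respect to (0,P) satisfy Re c_n(φ) = (γ ã P/(π(ã²P² + n²))) sinh(π ã P) cosh(π ã P + b̃) and Im c_n(φ) = (γ n/(π(ã²P² + n²))) sinh(π ã P) sinh(π ã P + b̃). In particular, c_n(φ) ≠ 0 for all n ∈ ℕ. -/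
open Real

/-- The integral of `cosh (α t + b) e^{-iωt}` over a period of `e^{-iωt}`. -/
theorem integral_cosh_mul_exp {α ω P : ℝ} (b : ℝ) (hα : α ≠ 0)
    (hωP : Complex.exp (-(ω * P * Complex.I)) = 1) :
    ∫ t in (0:ℝ)..P, (Real.cosh (α * t + b) : ℂ) * Complex.exp (-(ω * t * Complex.I)) =
      (α * (Real.sinh (α * P + b) - Real.sinh b)
        + ω * (Real.cosh (α * P + b) - Real.cosh b) * Complex.I) / (α ^ 2 + ω ^ 2) := by
  have hne : (α : ℂ) ^ 2 + (ω : ℂ) ^ 2 ≠ 0 := by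
    exact_mod_cast (by positivity : α ^ 2 + ω ^ 2 ≠ 0)
  have hderiv : ∀ t : ℝ, HasDerivAt
      (fun t : ℝ ↦ (α * (Real.sinh (α * t + b) : ℂ) + ω * (Real.cosh (α * t + b) : ℂ) * Complex.I)
        * Complex.exp (-(ω * t * Complex.I)) / (α ^ 2 + ω ^ 2))
      ((Real.cosh (α * t + b) : ℂ) * Complex.exp (-(ω * t * Complex.I))) t := by
    intro t
    have hlin : HasDerivAt (fun t : ℝ ↦ α * t + b) α t := by
      simpa using ((hasDerivAt_id t).const_mul α).add_const b
    have hsinh := hlin.sinh.ofReal_comp.const_mul (α : ℂ)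
    have hcosh := (hlin.cosh.ofReal_comp.const_mul (ω : ℂ)).mul_const Complex.I
    have hexp : HasDerivAt (fun t : ℝ ↦ Complex.exp (-(ω * t * Complex.I)))
        (Complex.exp (-(ω * t * Complex.I)) * -(ω * 1 * Complex.I)) t :=
      (((hasDerivAt_id t).ofReal_comp.const_mul (ω : ℂ)).mul_const Complex.I).neg.cexp
    refine (((hsinh.add hcosh).mul hexp).div_const _).congr_deriv ?_
    rw [div_eq_iff hne]
    simp only [Pi.add_apply]
    push_cast
    linear_combination (-(ω : ℂ) ^ 2 * Complex.cosh (α * t + b)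
      * Complex.exp (-(ω * t * Complex.I))) * Complex.I_sq
  rw [intervalIntegral.integral_eq_sub_of_hasDerivAt (fun t _ ↦ hderiv t)
    (Continuous.intervalIntegrable (by fun_prop) _ _), hωP]
  simp
  ring

/-- **Fourier coefficients of a hyperbolic cosine term.**
For `φ(t) = γ cosh(2π ã t + b̃)` with `γ, ã > 0`, `b̃ ∈ ℝ` and `P > 0`, for every `n ∈ ℕ₀`
one has `Re c_n(φ) = (γãP/(π(ã²P² + n²))) sinh(πãP) cosh(πãP + b̃)` and
`Im c_n(φ) = (γn/(π(ã²P² + n²))) sinh(πãP) sinh(πãP + b̃)`; in particular `c_n(φ) ≠ 0`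
for all `n ∈ ℕ`. -/
theorem statement17 (γ a' b' P : ℝ) (hγ : 0 < γ) (ha : 0 < a') (hP : 0 < P)
    (φ : ℝ → ℝ) (hφ : ∀ t, φ t = γ * Real.cosh (2 * π * a' * t + b')) :
    (∀ n : ℕ,
      (fourierCoef P φ n).re
          = γ * a' * P / (π * (a' ^ 2 * P ^ 2 + (n : ℝ) ^ 2))
            * Real.sinh (π * a' * P) * Real.cosh (π * a' * P + b')
        ∧ (fourierCoef P φ n).im
          = γ * (n : ℝ) / (π * (a' ^ 2 * P ^ 2 + (n : ℝ) ^ 2))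
            * Real.sinh (π * a' * P) * Real.sinh (π * a' * P + b'))
    ∧ ∀ n : ℕ, fourierCoef P φ n ≠ 0 := by
  have hπ := Real.pi_pos
  have hcoef : ∀ n : ℕ, fourierCoef P φ n =
      ((γ * a' * P / (π * (a' ^ 2 * P ^ 2 + (n : ℝ) ^ 2))
          * Real.sinh (π * a' * P) * Real.cosh (π * a' * P + b') : ℝ) : ℂ)
        + ((γ * (n : ℝ) / (π * (a' ^ 2 * P ^ 2 + (n : ℝ) ^ 2))
          * Real.sinh (π * a' * P) * Real.sinh (π * a' * P + b') : ℝ) : ℂ) * Complex.I := by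
    intro n
    have hPC : (P : ℂ) ≠ 0 := by exact_mod_cast hP.ne'
    have hπC : (π : ℂ) ≠ 0 := by exact_mod_cast hπ.ne'
    have hperiod : Complex.exp (-((2 * π * n / P : ℝ) * P * Complex.I)) = 1 := by
      rw [Complex.exp_eq_one_iff]
      refine ⟨-n, ?_⟩
      push_cast
      field_simp
    have hint := integral_cosh_mul_exp b' (by positivity : 2 * π * a' ≠ 0) hperiod
    have hsinh : Real.sinh (2 * π * a' * P + b') - Real.sinh b' =
        2 * Real.sinh (π * a' * P) * Real.cosh (π * a' * P + b') := by
      have h₁ := Real.sinh_add (π * a' * P + b') (π * a' * P)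
      have h₂ := Real.sinh_sub (π * a' * P + b') (π * a' * P)
      rw [show π * a' * P + b' + π * a' * P = 2 * π * a' * P + b' by ring] at h₁
      rw [add_sub_cancel_left] at h₂
      linear_combination h₁ - h₂
    have hcosh : Real.cosh (2 * π * a' * P + b') - Real.cosh b' =
        2 * Real.sinh (π * a' * P) * Real.sinh (π * a' * P + b') := by
      have h₁ := Real.cosh_add (π * a' * P + b') (π * a' * P)
      have h₂ := Real.cosh_sub (π * a' * P + b') (π * a' * P)
      rw [show π * a' * P + b' + π * a' * P = 2 * π * a' * P + b' by ring] at h₁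
      rw [add_sub_cancel_left] at h₂
      linear_combination h₁ - h₂
    have hintegrand : ∀ t : ℝ, (φ t : ℂ) * Complex.exp
        (-2 * (π : ℂ) * Complex.I * ((n : ℤ) : ℂ) * (t : ℂ) / (P : ℂ)) =
        γ * ((Real.cosh (2 * π * a' * t + b') : ℂ)
          * Complex.exp (-((2 * π * n / P : ℝ) * t * Complex.I))) := by
      intro t
      rw [hφ, Complex.ofReal_mul, mul_assoc]
      congr 3
      push_cast
      ring
    have hD : (a' : ℂ) ^ 2 * P ^ 2 + (n : ℂ) ^ 2 ≠ 0 := by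
      exact_mod_cast (by positivity : a' ^ 2 * P ^ 2 + (n : ℝ) ^ 2 ≠ 0)
    have hden : ((2 * π * a' : ℝ) : ℂ) ^ 2 + ((2 * π * n / P : ℝ) : ℂ) ^ 2 =
        4 * π ^ 2 * (a' ^ 2 * P ^ 2 + n ^ 2) / P ^ 2 := by
      push_cast
      field_simp
      ring
    simp only [fourierCoef, hintegrand]
    rw [intervalIntegral.integral_const_mul, hint, ← Complex.ofReal_sub, ← Complex.ofReal_sub,
      hsinh, hcosh, hden]
    push_cast
    field_simp
    ring
  have hre : ∀ n : ℕ, (fourierCoef P φ n).re =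
      γ * a' * P / (π * (a' ^ 2 * P ^ 2 + (n : ℝ) ^ 2))
        * Real.sinh (π * a' * P) * Real.cosh (π * a' * P + b') := fun n ↦ by
    rw [hcoef, Complex.add_re, Complex.re_ofReal_mul, Complex.ofReal_re, Complex.I_re]
    ring
  refine ⟨fun n ↦ ⟨hre n, by
    rw [hcoef, Complex.add_im, Complex.im_ofReal_mul, Complex.ofReal_im, Complex.I_im]
    ring⟩, fun n h ↦ ?_⟩
  have hsinh_pos : 0 < Real.sinh (π * a' * P) := Real.sinh_pos_iff.mpr (by positivity)
  have hcosh_pos := Real.cosh_pos (π * a' * P + b')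
  have hre_pos : 0 < (fourierCoef P φ n).re := by
    rw [hre]
    positivity
  simp [h] at hre_pos
end

section
/- Let P > 0, γ ∈ (0,∞), ã ∈ (0,∞), b̃ ∈ ℝ, and set C = −ã²P², A = (γ ã P/π) sinh(π ã P) cosh(π ã P + b̃), B = (γ/π) sinh(π ã P) sinh(π ã P + b̃); these are the partial-fraction parameters of the term γ cosh(2π ã t + b̃). Then C < 0, A² + C B² > 0, A > 0, and the parameters are recovered by ã = √|C| / P and γ = (π/(√|C| · sinh(√|C| π))) · √(A² + C B²); moreover b̃ is uniquely determined by A, B, C (namely |π√|C| + b̃| = arccosh(A/√(A² + C B²)) and sign(π√|C| + b̃) = sign B), so the map (γ, ã, b̃) ↦ (A, B, C) is injective. -/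
open Real

/-- The inverse hyperbolic cosine mapping `[1, ∞)` onto `[0, ∞)`:
`arccosh x = log (x + √(x² − 1))`. -/
noncomputable def arccosh (x : ℝ) : ℝ := Real.log (x + Real.sqrt (x ^ 2 - 1))

theorem arccosh_cosh_eq_abs (u : ℝ) : arccosh (Real.cosh u) = |u| := by
  rw [← Real.cosh_abs]
  exact Real.arcosh_cosh (abs_nonneg u)

theorem sign_mul_sinh {k : ℝ} (hk : 0 < k) (u : ℝ) :
    Real.sign (k * Real.sinh u) = Real.sign u := by
  rcases lt_trichotomy u 0 with hu | rfl | hu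
  · rw [Real.sign_of_neg hu, Real.sign_of_neg (mul_neg_of_pos_of_neg hk (Real.sinh_neg_iff.2 hu))]
  · simp
  · rw [Real.sign_of_pos hu, Real.sign_of_pos (mul_pos hk (Real.sinh_pos_iff.2 hu))]

theorem sqrt_abs_neg_sq_mul_sq {a P : ℝ} (ha : 0 < a) (hP : 0 < P) :
    Real.sqrt |(-(a ^ 2 * P ^ 2))| = a * P := by
  rw [abs_neg, ← mul_pow, abs_of_nonneg (sq_nonneg _), Real.sqrt_sq (mul_pos ha hP).le]

/-- The quadratic form `A² + C B²` of the partial-fraction parameters is a perfect square. -/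
theorem sq_add_mul_sq_eq {P γ a b C A B : ℝ}
    (hC : C = -(a ^ 2 * P ^ 2))
    (hA : A = γ * a * P / π * Real.sinh (π * a * P) * Real.cosh (π * a * P + b))
    (hB : B = γ / π * Real.sinh (π * a * P) * Real.sinh (π * a * P + b)) :
    A ^ 2 + C * B ^ 2 = (γ * a * P / π * Real.sinh (π * a * P)) ^ 2 := by
  subst hC hA hB
  linear_combination (γ * a * P / π * Real.sinh (π * a * P)) ^ 2 *
    Real.cosh_sq_sub_sinh_sq (π * a * P + b)

/-- The amplitude of a hyperbolic term in terms of its partial-fraction parameters. -/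
theorem amplitude_eq {P γ a b C A B : ℝ} (hP : 0 < P) (hγ : 0 < γ) (ha : 0 < a)
    (hC : C = -(a ^ 2 * P ^ 2))
    (hA : A = γ * a * P / π * Real.sinh (π * a * P) * Real.cosh (π * a * P + b))
    (hB : B = γ / π * Real.sinh (π * a * P) * Real.sinh (π * a * P + b)) :
    γ = π / (Real.sqrt |C| * Real.sinh (Real.sqrt |C| * π))
        * Real.sqrt (A ^ 2 + C * B ^ 2) := by
  have hS : 0 < Real.sinh (π * a * P) := Real.sinh_pos_iff.2 (by positivity)
  rw [sq_add_mul_sq_eq hC hA hB, Real.sqrt_sq (by positivity), hC, sqrt_abs_neg_sq_mul_sq ha hP,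
    show a * P * π = π * a * P by ring]
  field_simp

/-- **Recovery of the parameters of a hyperbolic term from its partial-fraction
parameters.** For `γ, ã > 0`, `b̃ ∈ ℝ`, `P > 0` and `C = −ã²P²`,
`A = (γãP/π) sinh(πãP) cosh(πãP + b̃)`, `B = (γ/π) sinh(πãP) sinh(πãP + b̃)`, one has
`C < 0`, `A² + CB² > 0`, `A > 0`, `ã = √|C|/P`,
`γ = (π/(√|C| sinh(√|C| π))) √(A² + CB²)`, `|π√|C| + b̃| = arccosh(A/√(A² + CB²))`,
`sign(π√|C| + b̃) = sign B`; hence the map `(γ, ã, b̃) ↦ (A, B, C)` is injective. -/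
theorem statement18 (P γ a' b' : ℝ) (hP : 0 < P) (hγ : 0 < γ) (ha : 0 < a')
    (C A B : ℝ)
    (hC : C = -(a' ^ 2 * P ^ 2))
    (hA : A = γ * a' * P / π * Real.sinh (π * a' * P) * Real.cosh (π * a' * P + b'))
    (hB : B = γ / π * Real.sinh (π * a' * P) * Real.sinh (π * a' * P + b')) :
    C < 0 ∧ 0 < A ^ 2 + C * B ^ 2 ∧ 0 < A
    ∧ a' = Real.sqrt |C| / P
    ∧ γ = π / (Real.sqrt |C| * Real.sinh (Real.sqrt |C| * π))
        * Real.sqrt (A ^ 2 + C * B ^ 2)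
    ∧ |π * Real.sqrt |C| + b'| = arccosh (A / Real.sqrt (A ^ 2 + C * B ^ 2))
    ∧ Real.sign (π * Real.sqrt |C| + b') = Real.sign B
    ∧ ∀ γ₂ a₂ b₂ : ℝ, 0 < γ₂ → 0 < a₂ →
        C = -(a₂ ^ 2 * P ^ 2) →
        A = γ₂ * a₂ * P / π * Real.sinh (π * a₂ * P) * Real.cosh (π * a₂ * P + b₂) →
        B = γ₂ / π * Real.sinh (π * a₂ * P) * Real.sinh (π * a₂ * P + b₂) →
        γ₂ = γ ∧ a₂ = a' ∧ b₂ = b' := by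
  have hS : 0 < Real.sinh (π * a' * P) := Real.sinh_pos_iff.2 (by positivity)
  have hcosh := Real.cosh_pos (π * a' * P + b')
  have hK : 0 < γ * a' * P / π * Real.sinh (π * a' * P) := by positivity
  have hk : 0 < γ / π * Real.sinh (π * a' * P) := by positivity
  have hQ := sq_add_mul_sq_eq hC hA hB
  have hs : Real.sqrt |C| = a' * P := hC ▸ sqrt_abs_neg_sq_mul_sq ha hP
  refine ⟨?_, ?_, ?_, ?_, amplitude_eq hP hγ ha hC hA hB, ?_, ?_, ?_⟩
  · rw [hC, neg_lt_zero]
    positivity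
  · rw [hQ]
    positivity
  · rw [hA]
    positivity
  · rw [hs, mul_div_cancel_right₀ _ hP.ne']
  · rw [hQ, Real.sqrt_sq hK.le, hA, mul_div_cancel_left₀ _ hK.ne', arccosh_cosh_eq_abs, hs,
      mul_assoc]
  · rw [hB, sign_mul_sinh hk, hs, mul_assoc]
  · intro γ₂ a₂ b₂ hγ₂ ha₂ hC₂ hA₂ hB₂
    have hγγ : γ₂ = γ :=
      (amplitude_eq hP hγ₂ ha₂ hC₂ hA₂ hB₂).trans (amplitude_eq hP hγ ha hC hA hB).symm
    have hs₂ : Real.sqrt |C| = a₂ * P := hC₂ ▸ sqrt_abs_neg_sq_mul_sq ha₂ hP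
    have haa : a₂ = a' := mul_right_cancel₀ hP.ne' (hs₂.symm.trans hs)
    subst hγγ haa
    have hsinh := mul_left_cancel₀ hk.ne' (hB₂.symm.trans hB)
    exact ⟨rfl, rfl, add_left_cancel (Real.sinh_injective hsinh)⟩
end
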